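/- Let B ≥ 1, r ≥ 1, δ > 0, H ≥ 1, D' ≤ D, N ≥ 1. Let g and g̃ be self-attention layers with H heads and parameters (K_h, Q_h, V_h) and (K̃_h, Q̃_h, Ṽ_h) respectively, all with entrywise maximum absolute value at most B, and suppose ‖K_h − K̃_h‖_∞ ≤ δ, ‖Q_h − Q̃_h‖_∞ ≤ δ, and ‖V_h − Ṽ_h‖_∞ ≤ δ for all h. Then for every X ∈ ℝ^{D×N} with ‖X‖_∞ ≤ r and every column index i, ‖g(X)_i − g̃(X)_i‖_∞ ≤ 5 H B² D⁴ r³ δ. -/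

import Mathlib

open Matrix

/-- Softmax of a vector in ℝ^n: `softmax x i = exp (x i) / ∑ j, exp (x j)`. -/
noncomputable def softmax {n : ℕ} (x : Fin n → ℝ) : Fin n → ℝ :=
  fun i => Real.exp (x i) / ∑ j, Real.exp (x j)

/-- The `i`-th output column of an `H`-head self-attention layer with parameters
`K_h, Q_h ∈ ℝ^{D'×D}`, `V_h ∈ ℝ^{D×D}` applied to `X ∈ ℝ^{D×N}`:
`g(X)_i = x_i + ∑_h V_h X Softmax((K_h X)ᵀ (Q_h x_i))`. -/
noncomputable def attnCol {D Dp N : ℕ} (H : ℕ)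
    (K Q : Fin H → Matrix (Fin Dp) (Fin D) ℝ) (V : Fin H → Matrix (Fin D) (Fin D) ℝ)
    (X : Matrix (Fin D) (Fin N) ℝ) (i : Fin N) : Fin D → ℝ :=
  (fun k => X k i) +
    ∑ h : Fin H,
      (V h) *ᵥ (X *ᵥ softmax (fun m : Fin N =>
        ∑ a, (K h *ᵥ fun k => X k m) a * (Q h *ᵥ fun k => X k i) a))

/-- The trapezoid bound for the exponential on `[0, t]`. -/
theorem exp_sub_one_le_mul_exp_add_one_div_two {t : ℝ} (ht : 0 ≤ t) :
    Real.exp t - 1 ≤ t * ((Real.exp t + 1) / 2) := by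
  have hderiv : ∀ x : ℝ, HasDerivAt (fun x => x * ((Real.exp x + 1) / 2) - Real.exp x)
      ((1 - Real.exp x + x * Real.exp x) / 2) x := fun x => by
    have h := ((hasDerivAt_id' x).mul (((Real.hasDerivAt_exp x).add_const 1).div_const 2)).sub
      (Real.hasDerivAt_exp x)
    exact h.congr_deriv (by ring)
  have hmono : Monotone (fun x => x * ((Real.exp x + 1) / 2) - Real.exp x) := by
    refine monotone_of_deriv_nonneg (fun x => (hderiv x).differentiableAt) fun x => ?_
    rw [(hderiv x).deriv]
    have h := mul_le_mul_of_nonneg_right (Real.add_one_le_exp (-x)) (Real.exp_pos x).le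
    rw [← Real.exp_add, neg_add_cancel, Real.exp_zero] at h
    linarith
  have h := hmono ht
  simp only [Real.exp_zero, zero_mul] at h
  linarith

/-- The logarithmic mean is at most the arithmetic mean, in exponential form. -/
theorem abs_exp_sub_exp_le (x y : ℝ) :
    |Real.exp x - Real.exp y| ≤ |x - y| * ((Real.exp x + Real.exp y) / 2) := by
  wlog hxy : y ≤ x generalizing x y
  · rw [abs_sub_comm, abs_sub_comm x, add_comm]
    exact this y x (le_of_not_ge hxy)
  rw [abs_of_nonneg (sub_nonneg.2 (Real.exp_le_exp.2 hxy)), abs_of_nonneg (sub_nonneg.2 hxy)]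
  have h := mul_le_mul_of_nonneg_left
    (exp_sub_one_le_mul_exp_add_one_div_two (sub_nonneg.2 hxy)) (Real.exp_pos y).le
  have hx : Real.exp x = Real.exp y * Real.exp (x - y) := by rw [← Real.exp_add]; ring_nf
  rw [hx]
  linarith

theorem sum_exp_pos {n : ℕ} [NeZero n] (x : Fin n → ℝ) : 0 < ∑ j, Real.exp (x j) :=
  Finset.sum_pos (fun j _ => Real.exp_pos (x j)) Finset.univ_nonempty

theorem softmax_eq_exp_sub_log {n : ℕ} [NeZero n] (x : Fin n → ℝ) (i : Fin n) :
    softmax x i = Real.exp (x i - Real.log (∑ j, Real.exp (x j))) := by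
  rw [softmax, Real.exp_sub, Real.exp_log (sum_exp_pos x)]

theorem sum_softmax {n : ℕ} [NeZero n] (x : Fin n → ℝ) : ∑ i, softmax x i = 1 := by
  simp only [softmax, ← Finset.sum_div]
  exact div_self (sum_exp_pos x).ne'

theorem softmax_nonneg {n : ℕ} (x : Fin n → ℝ) (i : Fin n) : 0 ≤ softmax x i := by
  unfold softmax; positivity

theorem sum_abs_softmax {n : ℕ} [NeZero n] (x : Fin n → ℝ) : ∑ i, |softmax x i| = 1 := by
  simp only [abs_of_nonneg (softmax_nonneg x _), sum_softmax]

theorem log_sum_exp_sub_le {n : ℕ} [NeZero n] {x y : Fin n → ℝ} {ε : ℝ}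
    (h : ∀ i, x i - y i ≤ ε) :
    Real.log (∑ j, Real.exp (x j)) - Real.log (∑ j, Real.exp (y j)) ≤ ε := by
  have hle : ∑ j, Real.exp (x j) ≤ Real.exp ε * ∑ j, Real.exp (y j) := by
    rw [Finset.mul_sum]
    refine Finset.sum_le_sum fun j _ => ?_
    rw [← Real.exp_add]
    exact Real.exp_le_exp.2 (by linarith [h j])
  have hlog := Real.log_le_log (sum_exp_pos x) hle
  rw [Real.log_mul (Real.exp_pos ε).ne' (sum_exp_pos y).ne', Real.log_exp] at hlog
  linarith

/-- The softmax map is `2`-Lipschitz from the sup norm to the `ℓ¹` norm. -/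
theorem sum_abs_softmax_sub_le {n : ℕ} [NeZero n] {x y : Fin n → ℝ} {ε : ℝ}
    (h : ∀ i, |x i - y i| ≤ ε) : ∑ i, |softmax x i - softmax y i| ≤ 2 * ε := by
  have hxy := log_sum_exp_sub_le fun i => (abs_le.1 (h i)).2
  have hyx := log_sum_exp_sub_le (x := y) (y := x) (ε := ε)
    fun i => by linarith [(abs_le.1 (h i)).1]
  calc ∑ i, |softmax x i - softmax y i|
      ≤ ∑ i, 2 * ε * ((softmax x i + softmax y i) / 2) := by
        refine Finset.sum_le_sum fun i _ => ?_
        have hi := abs_le.1 (h i)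
        have hmean : 0 ≤ (softmax x i + softmax y i) / 2 := by
          linarith [softmax_nonneg x i, softmax_nonneg y i]
        rw [softmax_eq_exp_sub_log, softmax_eq_exp_sub_log] at hmean ⊢
        refine (abs_exp_sub_exp_le _ _).trans (mul_le_mul_of_nonneg_right ?_ hmean)
        rw [abs_le]
        constructor <;> linarith
    _ = 2 * ε := by
        rw [← Finset.mul_sum, ← Finset.sum_div, Finset.sum_add_distrib, sum_softmax, sum_softmax]
        ring

theorem abs_mulVec_le_mul_sum_abs {m n : Type*} [Fintype n] {A : Matrix m n ℝ} {b : ℝ}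
    (hA : ∀ i j, |A i j| ≤ b) (x : n → ℝ) (i : m) : |(A *ᵥ x) i| ≤ b * ∑ j, |x j| := by
  rw [Finset.mul_sum]
  refine (Finset.abs_sum_le_sum_abs _ _).trans (Finset.sum_le_sum fun j _ => ?_)
  rw [abs_mul]
  exact mul_le_mul_of_nonneg_right (hA i j) (abs_nonneg _)

theorem abs_mulVec_le {m : Type*} {n : ℕ} {A : Matrix m (Fin n) ℝ} {b c : ℝ} (hb : 0 ≤ b)
    (hA : ∀ i j, |A i j| ≤ b) {x : Fin n → ℝ} (hx : ∀ j, |x j| ≤ c) (i : m) :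
    |(A *ᵥ x) i| ≤ b * (n * c) := by
  refine (abs_mulVec_le_mul_sum_abs hA x i).trans (mul_le_mul_of_nonneg_left ?_ hb)
  simpa using Finset.sum_le_sum fun j (_ : j ∈ Finset.univ) => hx j

/-- Perturbation bound for the attention logit `⟨K x, Q y⟩`. -/
theorem abs_attention_logit_sub_le {D Dp : ℕ} (hDp : Dp ≤ D) {B r δ : ℝ} (hB : 0 ≤ B)
    (hr : 0 ≤ r) (hδ : 0 ≤ δ) {K Q K' Q' : Matrix (Fin Dp) (Fin D) ℝ}
    (hK : ∀ a i, |K a i| ≤ B) (hQ' : ∀ a i, |Q' a i| ≤ B)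
    (hdK : ∀ a i, |K a i - K' a i| ≤ δ) (hdQ : ∀ a i, |Q a i - Q' a i| ≤ δ)
    {x y : Fin D → ℝ} (hx : ∀ k, |x k| ≤ r) (hy : ∀ k, |y k| ≤ r) :
    |∑ a, (K *ᵥ x) a * (Q *ᵥ y) a - ∑ a, (K' *ᵥ x) a * (Q' *ᵥ y) a| ≤
      2 * (D : ℝ) ^ 3 * B * r ^ 2 * δ := by
  have hterm : ∀ a, |(K *ᵥ x) a * (Q *ᵥ y) a - (K' *ᵥ x) a * (Q' *ᵥ y) a| ≤
      2 * (D : ℝ) ^ 2 * B * r ^ 2 * δ := fun a => by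
    have hsplit : (K *ᵥ x) a * (Q *ᵥ y) a - (K' *ᵥ x) a * (Q' *ᵥ y) a =
        (K *ᵥ x) a * ((Q - Q') *ᵥ y) a + ((K - K') *ᵥ x) a * (Q' *ᵥ y) a := by
      simp only [Matrix.sub_mulVec, Pi.sub_apply]
      ring
    rw [hsplit]
    calc _ ≤ |(K *ᵥ x) a| * |((Q - Q') *ᵥ y) a| + |((K - K') *ᵥ x) a| * |(Q' *ᵥ y) a| := by
          rw [← abs_mul, ← abs_mul]
          exact abs_add_le _ _
      _ ≤ (B * (D * r)) * (δ * (D * r)) + (δ * (D * r)) * (B * (D * r)) := by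
          gcongr
          · exact abs_mulVec_le hB hK hx a
          · exact abs_mulVec_le hδ hdQ hy a
          · exact abs_mulVec_le hδ hdK hx a
          · exact abs_mulVec_le hB hQ' hy a
      _ = _ := by ring
  rw [← Finset.sum_sub_distrib]
  calc _ ≤ ∑ _a : Fin Dp, 2 * (D : ℝ) ^ 2 * B * r ^ 2 * δ :=
        (Finset.abs_sum_le_sum_abs _ _).trans (Finset.sum_le_sum fun a _ => hterm a)
    _ = Dp * (2 * (D : ℝ) ^ 2 * B * r ^ 2 * δ) := by simp
    _ ≤ D * (2 * (D : ℝ) ^ 2 * B * r ^ 2 * δ) := by gcongr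
    _ = _ := by ring

/-- Perturbation bound for `V X p` in the value matrix `V` and the weight vector `p`. -/
theorem abs_value_mulVec_sub_le {D N : ℕ} {B r δ η : ℝ} (hB : 0 ≤ B) (hr : 0 ≤ r) (hδ : 0 ≤ δ)
    {V V' : Matrix (Fin D) (Fin D) ℝ} (hV' : ∀ k i, |V' k i| ≤ B)
    (hdV : ∀ k i, |V k i - V' k i| ≤ δ) {X : Matrix (Fin D) (Fin N) ℝ}
    (hX : ∀ k m, |X k m| ≤ r) {p p' : Fin N → ℝ} (hp : ∑ m, |p m| ≤ 1)
    (hpp : ∑ m, |p m - p' m| ≤ η) (k : Fin D) :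
    |(V *ᵥ (X *ᵥ p)) k - (V' *ᵥ (X *ᵥ p')) k| ≤ δ * (D * r) + B * (D * (r * η)) := by
  have hsplit : (V *ᵥ (X *ᵥ p)) k - (V' *ᵥ (X *ᵥ p')) k =
      ((V - V') *ᵥ (X *ᵥ p)) k + (V' *ᵥ (X *ᵥ (p - p'))) k := by
    simp only [Matrix.sub_mulVec, Matrix.mulVec_sub, Pi.sub_apply]
    ring
  rw [hsplit]
  refine (abs_add_le _ _).trans (add_le_add (abs_mulVec_le hδ hdV (fun j => ?_) k)
    (abs_mulVec_le hB hV' (fun j => ?_) k))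
  · exact (abs_mulVec_le_mul_sum_abs hX p j).trans (mul_le_of_le_one_right hr hp)
  · exact (abs_mulVec_le_mul_sum_abs hX (p - p') j).trans (mul_le_mul_of_nonneg_left hpp hr)

/-- Parameter-perturbation bound for self-attention layers: if two attention layers with
parameters within `δ` of each other (all entries bounded by `B`) are applied to the same
`X` with `‖X‖_∞ ≤ r`, then `‖g(X)_i − g̃(X)_i‖_∞ ≤ 5 H B² D⁴ r³ δ`. -/
theorem attention_parameter_perturbation (D Dp N H : ℕ) (hDp : Dp ≤ D) (hN : 1 ≤ N)
    (hH : 1 ≤ H) (B r δ : ℝ) (hB : 1 ≤ B) (hr : 1 ≤ r) (hδ : 0 < δ)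
    (K Q K' Q' : Fin H → Matrix (Fin Dp) (Fin D) ℝ)
    (V V' : Fin H → Matrix (Fin D) (Fin D) ℝ)
    (hK : ∀ h a i, |K h a i| ≤ B) (hQ : ∀ h a i, |Q h a i| ≤ B)
    (hV : ∀ h k i, |V h k i| ≤ B)
    (hK' : ∀ h a i, |K' h a i| ≤ B) (hQ' : ∀ h a i, |Q' h a i| ≤ B)
    (hV' : ∀ h k i, |V' h k i| ≤ B)
    (hdK : ∀ h a i, |K h a i - K' h a i| ≤ δ)
    (hdQ : ∀ h a i, |Q h a i - Q' h a i| ≤ δ)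
    (hdV : ∀ h k i, |V h k i - V' h k i| ≤ δ)
    (X : Matrix (Fin D) (Fin N) ℝ) (hX : ∀ k m, |X k m| ≤ r) :
    ∀ (i : Fin N) (k : Fin D),
      |attnCol H K Q V X i k - attnCol H K' Q' V' X i k| ≤
        5 * H * B ^ 2 * (D : ℝ) ^ 4 * r ^ 3 * δ := by
  intro i k
  have hB0 : 0 ≤ B := by linarith
  have hr0 : 0 ≤ r := by linarith
  have : NeZero N := ⟨by omega⟩
  have hD : (1 : ℝ) ≤ D := by exact_mod_cast (Nat.succ_le_of_lt k.pos)
  have hlow : δ * (D * r) ≤ B ^ 2 * (D : ℝ) ^ 4 * r ^ 3 * δ := by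
    have h : 1 * (D : ℝ) * r ≤ B ^ 2 * (D : ℝ) ^ 4 * r ^ 3 := by
      gcongr
      · exact one_le_pow₀ hB
      · exact le_self_pow₀ hD (by norm_num)
      · exact le_self_pow₀ hr (by norm_num)
    nlinarith
  simp only [attnCol, Pi.add_apply, Finset.sum_apply, add_sub_add_left_eq_sub]
  rw [← Finset.sum_sub_distrib]
  refine (Finset.abs_sum_le_sum_abs _ _).trans ?_
  calc _ ≤ ∑ _h : Fin H, 5 * B ^ 2 * (D : ℝ) ^ 4 * r ^ 3 * δ := by
        refine Finset.sum_le_sum fun h _ => ?_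
        have hweights := sum_abs_softmax_sub_le fun m =>
          abs_attention_logit_sub_le hDp hB0 hr0 hδ.le (hK h) (hQ' h) (hdK h) (hdQ h)
            (fun k => hX k m) (fun k => hX k i)
        refine (abs_value_mulVec_sub_le hB0 hr0 hδ.le (hV' h) (hdV h) hX
          (sum_abs_softmax _).le hweights k).trans ?_
        linarith
    _ = _ := by
        rw [Finset.sum_const, Finset.card_univ, Fintype.card_fin, nsmul_eq_mul]
        ring
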